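/- For every y ∈ F(Σ), the equality u₁·g(y)·u₂ = v₁·h(y)·v₂ holds in F(Δ) if and only if g'(B·ιΣ(y)·E) = h'(B·ιΣ(y)·E) holds in F(Δ'). Moreover, B·ιΣ(y)·E ≠ 1 in F(Σ') for every y ∈ F(Σ). -/

import Mathlib

namespace PCP

/-- The extended source alphabet `Σ' = Σ ⊔ {B, E}`: `Sum.inr false` is `B`, `Sum.inr true` is `E`. -/
abbrev Sig' (S : Type*) := S ⊕ Bool

/-- The extended target alphabet `Δ' = Δ ⊔ {B, E, #}`:
`Sum.inr 0` is `B`, `Sum.inr 1` is `E`, `Sum.inr 2` is `#`. -/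
abbrev Del' (D : Type*) := D ⊕ Fin 3

/-- The generator `B` of `F(Σ')`. -/
def Bs {S : Type*} : FreeGroup (Sig' S) := FreeGroup.of (Sum.inr false)

/-- The generator `E` of `F(Σ')`. -/
def Es {S : Type*} : FreeGroup (Sig' S) := FreeGroup.of (Sum.inr true)

/-- The generator `B` of `F(Δ')`. -/
def Bd {D : Type*} : FreeGroup (Del' D) := FreeGroup.of (Sum.inr 0)

/-- The generator `E` of `F(Δ')`. -/
def Ed {D : Type*} : FreeGroup (Del' D) := FreeGroup.of (Sum.inr 1)

/-- The generator `#` of `F(Δ')`. -/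
def hsh {D : Type*} : FreeGroup (Del' D) := FreeGroup.of (Sum.inr 2)

/-- The inclusion `ιΣ : F(Σ) → F(Σ')`. -/
def incS {S : Type*} : FreeGroup S →* FreeGroup (Sig' S) := FreeGroup.map Sum.inl

/-- The inclusion `ι : F(Δ) → F(Δ')`. -/
def incD {D : Type*} : FreeGroup D →* FreeGroup (Del' D) := FreeGroup.map Sum.inl

/-- The homomorphism `g' : F(Σ') → F(Δ')` associated to `g, u₁, u₂`. -/
def gMap {S D : Type*} (g : FreeGroup S →* FreeGroup D) (u₁ u₂ : FreeGroup D) :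
    FreeGroup (Sig' S) →* FreeGroup (Del' D) :=
  FreeGroup.lift fun z => match z with
    | Sum.inl s => hsh⁻¹ * incD (g (FreeGroup.of s)) * hsh
    | Sum.inr false => Bd * hsh * incD u₁ * hsh
    | Sum.inr true => hsh⁻¹ * incD u₂ * hsh * Ed

/-- The homomorphism `h' : F(Σ') → F(Δ')` associated to `h, v₁, v₂`. -/
def hMap {S D : Type*} (h : FreeGroup S →* FreeGroup D) (v₁ v₂ : FreeGroup D) :
    FreeGroup (Sig' S) →* FreeGroup (Del' D) :=
  FreeGroup.lift fun z => match z with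
    | Sum.inl s => hsh * incD (h (FreeGroup.of s)) * hsh⁻¹
    | Sum.inr false => Bd * hsh * incD v₁ * hsh⁻¹
    | Sum.inr true => hsh * incD v₂ * hsh * Ed

end PCP


namespace PCP

variable {S D : Type*}

lemma incD_injective : Function.Injective (incD : FreeGroup D →* FreeGroup (Del' D)) :=
  FreeGroup.map_injective Sum.inl_injective

lemma gMap_incS (g : FreeGroup S →* FreeGroup D) (u₁ u₂ : FreeGroup D) (y : FreeGroup S) :
    gMap g u₁ u₂ (incS y) = hsh⁻¹ * incD (g y) * hsh := by
  have key : (gMap g u₁ u₂).comp incS =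
      (MulAut.conj (hsh⁻¹ : FreeGroup (Del' D))).toMonoidHom.comp (incD.comp g) := by
    ext s
    simp [gMap, incS]
  simpa using DFunLike.congr_fun key y

lemma hMap_incS (h : FreeGroup S →* FreeGroup D) (v₁ v₂ : FreeGroup D) (y : FreeGroup S) :
    hMap h v₁ v₂ (incS y) = hsh * incD (h y) * hsh⁻¹ := by
  have key : (hMap h v₁ v₂).comp incS =
      (MulAut.conj (hsh : FreeGroup (Del' D))).toMonoidHom.comp (incD.comp h) := by
    ext s
    simp [hMap, incS]
  simpa using DFunLike.congr_fun key y

lemma gMap_Bs_mul_incS_mul_Es (g : FreeGroup S →* FreeGroup D) (u₁ u₂ : FreeGroup D)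
    (y : FreeGroup S) :
    gMap g u₁ u₂ (Bs * incS y * Es) = Bd * hsh * incD (u₁ * g y * u₂) * (hsh * Ed) := by
  have hB : gMap g u₁ u₂ Bs = Bd * hsh * incD u₁ * hsh := by simp [gMap, Bs]
  have hE : gMap g u₁ u₂ Es = hsh⁻¹ * incD u₂ * hsh * Ed := by simp [gMap, Es]
  simp only [map_mul, gMap_incS, hB, hE]
  group

lemma hMap_Bs_mul_incS_mul_Es (h : FreeGroup S →* FreeGroup D) (v₁ v₂ : FreeGroup D)
    (y : FreeGroup S) :
    hMap h v₁ v₂ (Bs * incS y * Es) = Bd * hsh * incD (v₁ * h y * v₂) * (hsh * Ed) := by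
  have hB : hMap h v₁ v₂ Bs = Bd * hsh * incD v₁ * hsh⁻¹ := by simp [hMap, Bs]
  have hE : hMap h v₁ v₂ Es = hsh * incD v₂ * hsh * Ed := by simp [hMap, Es]
  simp only [map_mul, hMap_incS, hB, hE]
  group

lemma Bs_mul_incS_mul_Es_ne_one (y : FreeGroup S) :
    (Bs * incS y * Es : FreeGroup (Sig' S)) ≠ 1 := by
  let φ : FreeGroup (Sig' S) →* Multiplicative ℤ :=
    FreeGroup.lift (Sum.elim 1 fun b => if b then 1 else Multiplicative.ofAdd 1)
  have hy : φ (incS y) = 1 := by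
    have key : φ.comp incS = 1 := by
      ext s
      simp [φ, incS]
    exact DFunLike.congr_fun key y
  intro h
  simpa [hy, φ, Bs, Es] using congrArg φ h

end PCP

open PCP in
/-- `y ∈ F(Σ)` is a solution to the GPCP instance iff `B·ιΣ(y)·E` is a solution to the
associated PCP instance; moreover `B·ιΣ(y)·E` is never trivial. -/
theorem solution_iff_solution {S D : Type*} (g h : FreeGroup S →* FreeGroup D)
    (u₁ u₂ v₁ v₂ : FreeGroup D) :
    ∀ y : FreeGroup S,
      (u₁ * g y * u₂ = v₁ * h y * v₂ ↔
        gMap g u₁ u₂ (Bs * incS y * Es) = hMap h v₁ v₂ (Bs * incS y * Es)) ∧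
      (Bs * incS y * Es : FreeGroup (Sig' S)) ≠ 1 := by
  intro y
  refine ⟨?_, Bs_mul_incS_mul_Es_ne_one y⟩
  rw [gMap_Bs_mul_incS_mul_Es, hMap_Bs_mul_incS_mul_Es, mul_left_inj, mul_right_inj,
    incD_injective.eq_iff]
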